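/- arXiv:1801.09301 — 6 statements merged into one kernel-verified Lean document; each statement's English description precedes it below -/
import Mathlib

section
/- Let U and V be sets, s ≥ 1 an integer and D ≥ 1 a real number. Suppose E ⊆ U × V is K_{s,2}-free and admits cuttings with exponent D. Then for every real δ with 0 < δ < 1/(2(2D−1)) there is a constant C > 0 such that for every n ∈ ℕ and all finite A ⊆ U, B ⊆ V with |A| ≤ n and |B| ≤ n, one has |E ∩ (A × B)| ≤ C·n^{3/2−δ}. -/
open Set

/-- The fiber of a binary relation `E ⊆ U × V` at `a ∈ U`. -/
def fiber {U V : Type*} (E : Set (U × V)) (a : U) : Set V := {v | (a, v) ∈ E}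

/-- A set `S` crosses a set `W` if `S ∩ W ≠ ∅` and `W ⊄ S`. -/
def Crosses {V : Type*} (S W : Set V) : Prop := S ∩ W ≠ ∅ ∧ ¬ W ⊆ S

/-- `E` admits cuttings with exponent `D`. -/
def AdmitsCuttings {U V : Type*} (E : Set (U × V)) (D : ℝ) : Prop :=
  ∃ c₀ : ℝ, ∀ (n : ℕ) (A : Set U), A.Finite → A.ncard ≤ n →
    ∀ r : ℝ, 1 < r → r < (n : ℝ) →
      ∃ (t : ℕ) (Vs : Fin t → Set V),
        (⋃ i, Vs i) = Set.univ ∧ (t : ℝ) ≤ c₀ * r ^ D ∧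
        ∀ i : Fin t,
          (({S : Set V | (∃ a ∈ A, S = fiber E a) ∧ Crosses S (Vs i)}.ncard : ℝ)
            ≤ (n : ℝ) / r)

/-- `E ⊆ U × V` is `K_{s,t}`-free. -/
def KstFree {U V : Type*} (E : Set (U × V)) (s t : ℕ) : Prop :=
  ¬ ∃ (A : Set U) (B : Set V),
      A.Finite ∧ B.Finite ∧ A.ncard = s ∧ B.ncard = t ∧ A ×ˢ B ⊆ E

open scoped Classical in
/-- The number of incidences of `E` between the finite sets `A` and `B`. -/
noncomputable def incidences {U V : Type*} (E : Set (U × V)) (A : Finset U) (B : Finset V) : ℕ :=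
  ∑ a ∈ A, ∑ b ∈ B, if (a, b) ∈ E then 1 else 0

section Incidences

open scoped Classical

variable {U V : Type*} {E : Set (U × V)} {s : ℕ}

lemma incidences_eq_sum_card (A : Finset U) (B : Finset V) :
    incidences E A B = ∑ a ∈ A, (B.filter fun b => (a, b) ∈ E).card := by
  simp only [incidences, Finset.card_filter]

lemma incidences_le_card_mul_card (A : Finset U) (B : Finset V) :
    incidences E A B ≤ A.card * B.card := by
  rw [incidences_eq_sum_card, ← smul_eq_mul, ← Finset.sum_const]
  exact Finset.sum_le_sum fun a _ => Finset.card_filter_le _ _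

lemma incidences_filter_add_filter_not (A : Finset U) (B : Finset V) (p : U → Prop) :
    incidences E (A.filter p) B + incidences E (A.filter fun a => ¬ p a) B =
      incidences E A B :=
  Finset.sum_filter_add_sum_filter_not A p _

lemma incidences_eq_sum_cells {ι : Type*} [Fintype ι] [DecidableEq ι] (A : Finset U)
    (B : Finset V) (f : V → ι) :
    incidences E A B = ∑ i, incidences E A (B.filter fun b => f b = i) := by
  unfold incidences
  rw [Finset.sum_comm (s := Finset.univ)]
  exact Finset.sum_congr rfl fun a _ => (Finset.sum_fiberwise B f _).symm

lemma KstFree.card_common_le (h : KstFree E s 2) (A : Finset U) {b b' : V} (hb : b ≠ b') :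
    (A.filter fun a => (a, b) ∈ E ∧ (a, b') ∈ E).card ≤ s := by
  by_contra! hlt
  obtain ⟨A', hA', hcard⟩ := Finset.exists_subset_card_eq hlt.le
  refine h ⟨A', {b, b'}, A'.finite_toSet, by simp, by simpa using hcard,
    Set.ncard_pair hb, ?_⟩
  rintro ⟨a, v⟩ ⟨ha, hv⟩
  have := (Finset.mem_filter.1 (hA' (by simpa using ha))).2
  rcases hv with rfl | rfl
  exacts [this.1, this.2]

lemma KstFree.sum_card_sq_le (h : KstFree E s 2) (A : Finset U) (B : Finset V) :
    ∑ a ∈ A, (B.filter fun b => (a, b) ∈ E).card ^ 2 ≤ incidences E A B + s * B.card ^ 2 := by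
  have hsq : ∀ a, (B.filter fun b => (a, b) ∈ E).card ^ 2 =
      ∑ b ∈ B, ∑ b' ∈ B, if (a, b) ∈ E ∧ (a, b') ∈ E then 1 else 0 := by
    intro a
    rw [Finset.card_filter, sq, Finset.sum_mul_sum]
    refine Finset.sum_congr rfl fun b _ => Finset.sum_congr rfl fun b' _ => ?_
    by_cases h1 : (a, b) ∈ E <;> by_cases h2 : (a, b') ∈ E <;> simp [h1, h2]
  have hcod : ∀ b ∈ B, ∑ b' ∈ B, ∑ a ∈ A, (if (a, b) ∈ E ∧ (a, b') ∈ E then 1 else 0) ≤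
      (∑ a ∈ A, if (a, b) ∈ E then 1 else 0) + B.card * s := by
    intro b hb
    rw [← Finset.add_sum_erase B _ hb]
    refine Nat.add_le_add (by simp) ?_
    calc _ ≤ ∑ b' ∈ B.erase b, s := by
          refine Finset.sum_le_sum fun b' hb' => ?_
          rw [← Finset.card_filter]
          exact h.card_common_le A (Finset.ne_of_mem_erase hb').symm
      _ ≤ B.card * s := by
          rw [Finset.sum_const, smul_eq_mul]
          exact Nat.mul_le_mul_right _ (Finset.card_le_card (Finset.erase_subset _ _))
  calc _ = ∑ b ∈ B, ∑ b' ∈ B, ∑ a ∈ A, (if (a, b) ∈ E ∧ (a, b') ∈ E then 1 else 0) := by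
        simp_rw [hsq]
        rw [Finset.sum_comm]
        exact Finset.sum_congr rfl fun b _ => Finset.sum_comm
    _ ≤ ∑ b ∈ B, ((∑ a ∈ A, if (a, b) ∈ E then 1 else 0) + B.card * s) :=
        Finset.sum_le_sum hcod
    _ = incidences E A B + s * B.card ^ 2 := by
        rw [Finset.sum_add_distrib, Finset.sum_comm, Finset.sum_const, smul_eq_mul, incidences]
        ring

/-- The Kővári–Sós–Turán bound for `K_{s,2}`-free relations. -/
lemma KstFree.incidences_le (h : KstFree E s 2) (A : Finset U) (B : Finset V) {m : ℝ}
    (hm : (A.card : ℝ) ≤ m) :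
    (incidences E A B : ℝ) ≤ √(s * m) * B.card + m := by
  have hm0 : 0 ≤ m := (Nat.cast_nonneg _).trans hm
  have hcs : (incidences E A B : ℝ) ^ 2 ≤
      A.card * (incidences E A B + s * (B.card : ℝ) ^ 2) := by
    have h1 : incidences E A B ^ 2 ≤ A.card * (incidences E A B + s * B.card ^ 2) := by
      calc incidences E A B ^ 2
          = (∑ a ∈ A, (B.filter fun b => (a, b) ∈ E).card) ^ 2 := by
            rw [incidences_eq_sum_card]
        _ ≤ A.card * ∑ a ∈ A, (B.filter fun b => (a, b) ∈ E).card ^ 2 :=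
            sq_sum_le_card_mul_sum_sq
        _ ≤ _ := Nat.mul_le_mul_left _ (h.sum_card_sq_le A B)
    exact_mod_cast h1
  have hI : (0 : ℝ) ≤ incidences E A B := Nat.cast_nonneg _
  have hcs' : (incidences E A B : ℝ) ^ 2 ≤ m * (incidences E A B + s * (B.card : ℝ) ^ 2) :=
    hcs.trans (by gcongr)
  have hsqrt : √(s * m) ^ 2 = s * m := Real.sq_sqrt (by positivity)
  have hx : 0 ≤ √(s * m) * B.card := by positivity
  have hx2 : (√(s * m) * B.card) ^ 2 = m * (s * (B.card : ℝ) ^ 2) := by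
    rw [mul_pow, hsqrt]; ring
  by_contra! hlt
  nlinarith

lemma KstFree.incidences_not_crosses_le (h : KstFree E s 2) (A : Finset U) (B : Finset V)
    {W : Set V} (hB : ∀ b ∈ B, b ∈ W) :
    incidences E (A.filter fun a => ¬ Crosses (fiber E a) W) B ≤ A.card + s * B.card := by
  rcases le_or_gt B.card 1 with hB1 | hB1
  · calc _ ≤ (A.filter fun a => ¬ Crosses (fiber E a) W).card * B.card :=
          incidences_le_card_mul_card _ _
      _ ≤ A.card * 1 := Nat.mul_le_mul (Finset.card_filter_le _ _) hB1
      _ ≤ _ := by omega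
  · obtain ⟨b, hb, b', hb', hne⟩ := Finset.one_lt_card.1 hB1
    have hfull : ∀ a, ¬ Crosses (fiber E a) W → ∀ v ∈ B, (a, v) ∈ E → W ⊆ fiber E a := by
      intro a ha v hv hav
      by_contra hW
      exact ha ⟨Set.nonempty_iff_ne_empty.1 ⟨v, hav, hB v hv⟩, hW⟩
    rw [incidences]
    simp_rw [Finset.sum_comm (t := B), ← Finset.card_filter, Finset.filter_filter]
    calc _ ≤ ∑ v ∈ B, s := by
          refine Finset.sum_le_sum fun v hv => ?_
          refine (Finset.card_le_card fun a ha => ?_).trans (h.card_common_le A hne)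
          rw [Finset.mem_filter] at ha ⊢
          have hW := hfull a ha.2.1 v hv ha.2.2
          exact ⟨ha.1, hW (hB b hb), hW (hB b' hb')⟩
      _ = s * B.card := by rw [Finset.sum_const, smul_eq_mul, mul_comm]
      _ ≤ _ := Nat.le_add_left _ _

lemma KstFree.card_crosses_le (h : KstFree E s 2) (A : Finset U)
    (hA : ∀ a ∈ A, (fiber E a).Nontrivial) (W : Set V) :
    (A.filter fun a => Crosses (fiber E a) W).card ≤
      s * {S : Set V | (∃ a ∈ (A : Set U), S = fiber E a) ∧ Crosses S W}.ncard := by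
  have himage : {S : Set V | (∃ a ∈ (A : Set U), S = fiber E a) ∧ Crosses S W} =
      (((A.filter fun a => Crosses (fiber E a) W).image (fiber E) : Finset (Set V)) :
        Set (Set V)) := by
    ext S
    simp only [Set.mem_ofPred_eq, Finset.coe_image, Set.mem_image, Finset.mem_coe,
      Finset.mem_filter]
    constructor
    · rintro ⟨⟨a, ha, rfl⟩, hS⟩
      exact ⟨a, ⟨ha, hS⟩, rfl⟩
    · rintro ⟨a, ⟨ha, hS⟩, rfl⟩
      exact ⟨⟨a, ha, rfl⟩, hS⟩
  rw [himage, Set.ncard_coe_finset]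
  refine Finset.card_le_mul_card_image _ _ fun S hS => ?_
  obtain ⟨a, ha, rfl⟩ := Finset.mem_image.1 hS
  obtain ⟨b, hb, b', hb', hne⟩ := hA a (Finset.mem_filter.1 ha).1
  refine (Finset.card_le_card fun a' ha' => ?_).trans (h.card_common_le A hne)
  rw [Finset.mem_filter, Finset.mem_filter] at ha'
  refine Finset.mem_filter.2 ⟨ha'.1.1, ?_, ?_⟩
  · exact (ha'.2.symm ▸ hb : b ∈ fiber E a')
  · exact (ha'.2.symm ▸ hb' : b' ∈ fiber E a')

/-- The bound obtained from cutting recursively `j` times, where every cutting has at most `T`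
cells, each crossed by at most a `1 / ρ` proportion of the fibers. -/
lemma KstFree.incidences_le_of_cuttings (h : KstFree E s 2) {R ρ T : ℝ} (hR : 0 ≤ R)
    (hρ : 1 < ρ) (hρT : ρ ≤ T)
    (hcut : ∀ A : Finset U, (∀ a ∈ A, (fiber E a).Nontrivial) → R < A.card →
      ∃ (t : ℕ) (Vs : Fin t → Set V), (⋃ i, Vs i) = Set.univ ∧ (t : ℝ) ≤ T ∧
        ∀ i, ((A.filter fun a => Crosses (fiber E a) (Vs i)).card : ℝ) ≤ A.card / ρ)
    (j : ℕ) (A : Finset U) (B : Finset V) (hA : ∀ a ∈ A, (fiber E a).Nontrivial) {m : ℝ}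
    (hm : (A.card : ℝ) ≤ m) :
    (incidences E A B : ℝ) ≤
      √(s * (m / ρ ^ j)) * B.card + (R + j * s) * B.card + (j + 1) * T * (T / ρ) ^ j * m := by
  have hρ0 : 0 < ρ := by linarith
  have hT1 : 1 ≤ T := by linarith
  have hT0 : 0 ≤ T := by linarith
  have hTρ : 1 ≤ T / ρ := (one_le_div hρ0).2 hρT
  induction j generalizing A B m with
  | zero =>
    have hm0 : 0 ≤ m := (Nat.cast_nonneg _).trans hm
    have := h.incidences_le A B hm
    have h1 : 0 ≤ R * (B.card : ℝ) := by positivity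
    have h2 : m ≤ T * m := le_mul_of_one_le_left hm0 hT1
    simp only [pow_zero, div_one, Nat.cast_zero, zero_mul, add_zero, zero_add, one_mul, mul_one]
    linarith
  | succ j ih =>
    have hm0 : 0 ≤ m := (Nat.cast_nonneg _).trans hm
    rcases le_or_gt (A.card : ℝ) R with hAR | hAR
    · have h1 : (incidences E A B : ℝ) ≤ A.card * B.card := by
        exact_mod_cast incidences_le_card_mul_card A B
      have h2 : (A.card : ℝ) * B.card ≤ (R + ((j + 1 : ℕ) : ℝ) * s) * B.card := by
        gcongr
        have : (0 : ℝ) ≤ ((j + 1 : ℕ) : ℝ) * s := by positivity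
        linarith
      have h3 : 0 ≤ √(s * (m / ρ ^ (j + 1))) * B.card := by positivity
      have h4 : 0 ≤ (((j + 1 : ℕ) : ℝ) + 1) * T * (T / ρ) ^ (j + 1) * m := by positivity
      linarith
    · obtain ⟨t, Vs, hcover, ht, hcross⟩ := hcut A hA hAR
      have hmem : ∀ v, ∃ i, v ∈ Vs i := fun v => by
        simpa using (hcover.symm ▸ Set.mem_univ v : v ∈ ⋃ i, Vs i)
      choose f hf using hmem
      set K : Fin t → Finset V := fun i => B.filter fun b => f b = i
      have hKsum : ∑ i, ((K i).card : ℝ) = B.card := by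
        rw [← Nat.cast_sum, ← Finset.card_eq_sum_card_fiberwise (fun _ _ => Finset.mem_univ _)]
      have hcell : ∀ i, (incidences E A (K i) : ℝ) ≤
          √(s * (m / ρ ^ (j + 1))) * (K i).card + (R + (j + 1) * s) * (K i).card +
            ((j + 1) * T * (T / ρ) ^ j * (m / ρ) + m) := by
        intro i
        have h1 := ih (A.filter fun a => Crosses (fiber E a) (Vs i)) (K i)
          (fun a ha => hA a (Finset.mem_filter.1 ha).1) (m := m / ρ)
          ((hcross i).trans (by gcongr))
        have h2 := h.incidences_not_crosses_le A (K i) (W := Vs i) fun b hb =>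
          (Finset.mem_filter.1 hb).2 ▸ hf b
        have h2' : (incidences E (A.filter fun a => ¬ Crosses (fiber E a) (Vs i)) (K i) : ℝ) ≤
            A.card + s * (K i).card := by exact_mod_cast h2
        have h3 : (incidences E A (K i) : ℝ) = _ := congrArg Nat.cast
          (incidences_filter_add_filter_not (E := E) A (K i)
            fun a => Crosses (fiber E a) (Vs i)).symm
        rw [Nat.cast_add] at h3
        rw [div_div, ← pow_succ'] at h1
        rw [h3]
        linarith
      have hsum : (incidences E A B : ℝ) ≤
          √(s * (m / ρ ^ (j + 1))) * B.card + (R + (j + 1) * s) * B.card +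
            t * ((j + 1) * T * (T / ρ) ^ j * (m / ρ) + m) := by
        rw [incidences_eq_sum_cells A B f, Nat.cast_sum]
        refine (Finset.sum_le_sum fun i _ => hcell i).trans (le_of_eq ?_)
        rw [Finset.sum_add_distrib, Finset.sum_add_distrib, ← Finset.mul_sum, ← Finset.mul_sum,
          hKsum, Finset.sum_const, Finset.card_univ, Fintype.card_fin, nsmul_eq_mul]
      have hlast : t * ((j + 1) * T * (T / ρ) ^ j * (m / ρ) + m) ≤
          (j + 1 + 1) * T * (T / ρ) ^ (j + 1) * m := by
        have h1 : (1 : ℝ) ≤ (T / ρ) ^ (j + 1) := one_le_pow₀ hTρ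
        calc t * ((j + 1) * T * (T / ρ) ^ j * (m / ρ) + m)
            ≤ T * ((j + 1) * T * (T / ρ) ^ j * (m / ρ) + m) := by gcongr
          _ = (j + 1) * T * (T / ρ) ^ (j + 1) * m + T * 1 * m := by
              rw [pow_succ]; field_simp
          _ ≤ (j + 1) * T * (T / ρ) ^ (j + 1) * m + T * (T / ρ) ^ (j + 1) * m := by gcongr
          _ = _ := by ring
      push_cast
      linarith

lemma incidences_le_card_add_nontrivial (A : Finset U) (B : Finset V) :
    incidences E A B ≤
      A.card + incidences E (A.filter fun a => (fiber E a).Nontrivial) B := by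
  rw [← incidences_filter_add_filter_not A B fun a => (fiber E a).Nontrivial, add_comm]
  refine Nat.add_le_add_right ?_ _
  rw [incidences_eq_sum_card]
  calc _ ≤ ∑ a ∈ A.filter (fun a => ¬ (fiber E a).Nontrivial), 1 := by
        refine Finset.sum_le_sum fun a ha => Finset.card_le_one.2 fun b hb b' hb' => ?_
        exact Set.not_nontrivial_iff.1 (Finset.mem_filter.1 ha).2
          (Finset.mem_filter.1 hb).2 (Finset.mem_filter.1 hb').2
    _ ≤ A.card := by
        rw [← Finset.card_eq_sum_ones]
        exact Finset.card_filter_le _ _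

lemma ncard_inter_prod_eq_incidences (A : Finset U) (B : Finset V) :
    (E ∩ (A : Set U) ×ˢ (B : Set V)).ncard = incidences E A B := by
  have : E ∩ (A : Set U) ×ˢ (B : Set V) = ((A ×ˢ B).filter (· ∈ E) : Finset (U × V)) := by
    ext p
    simp [and_comm]
  rw [this, Set.ncard_coe_finset, Finset.card_filter, Finset.sum_product, incidences]

/-- Cuttings of fibers counted with multiplicity, in a `K_{s,2}`-free relation. -/
lemma KstFree.exists_cutting (h : KstFree E s 2) (hs : 1 ≤ s) {c₀ D : ℝ}
    (hcut : ∀ (n : ℕ) (A : Set U), A.Finite → A.ncard ≤ n →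
      ∀ r : ℝ, 1 < r → r < (n : ℝ) →
        ∃ (t : ℕ) (Vs : Fin t → Set V),
          (⋃ i, Vs i) = Set.univ ∧ (t : ℝ) ≤ c₀ * r ^ D ∧
          ∀ i : Fin t,
            (({S : Set V | (∃ a ∈ A, S = fiber E a) ∧ Crosses S (Vs i)}.ncard : ℝ)
              ≤ (n : ℝ) / r))
    {ρ : ℝ} (hρ : 1 < ρ) (A : Finset U) (hA : ∀ a ∈ A, (fiber E a).Nontrivial)
    (hcard : s * ρ < A.card) :
    ∃ (t : ℕ) (Vs : Fin t → Set V), (⋃ i, Vs i) = Set.univ ∧ (t : ℝ) ≤ c₀ * (s * ρ) ^ D ∧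
      ∀ i, ((A.filter fun a => Crosses (fiber E a) (Vs i)).card : ℝ) ≤ A.card / ρ := by
  have hs' : (1 : ℝ) ≤ s := by exact_mod_cast hs
  obtain ⟨t, Vs, hcover, ht, hcross⟩ := hcut A.card A A.finite_toSet (by simp) (s * ρ)
    (by nlinarith) hcard
  refine ⟨t, Vs, hcover, ht, fun i => ?_⟩
  have h1 : ((A.filter fun a => Crosses (fiber E a) (Vs i)).card : ℝ) ≤
      s * ({S : Set V | (∃ a ∈ (A : Set U), S = fiber E a) ∧ Crosses S (Vs i)}.ncard : ℝ) := by
    exact_mod_cast h.card_crosses_le A hA (Vs i)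
  calc _ ≤ _ := h1
    _ ≤ s * (A.card / (s * ρ)) := by gcongr; exact hcross i
    _ = A.card / ρ := by field_simp

end Incidences

/-- Choosing the recursion depth `j` so that `ρ ^ j` is about `n ^ (2 * δ)`. -/
lemma exists_depth {D δ η ρ : ℝ} (hD : 1 ≤ D) (hδ : 0 < δ) (hη : 0 < η)
    (hδη : 2 * δ * (D - 1 + 2 * η) = 1 / 2 - δ) (hρ : 1 < ρ) (hρη : 2 ≤ ρ ^ η)
    {n : ℕ} (hn : 1 ≤ n) :
    ∃ j : ℕ, (n : ℝ) ^ (2 * δ) ≤ ρ ^ j ∧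
      (j + 1) * (ρ ^ (D + η) / ρ) ^ j ≤ ρ ^ (D - 1 + 2 * η) * (n : ℝ) ^ (1 / 2 - δ) := by
  have hρ0 : 0 < ρ := by linarith
  have hn' : (1 : ℝ) ≤ n := by exact_mod_cast hn
  have hn0 : (0 : ℝ) ≤ n := by linarith
  obtain ⟨i, hi, hi'⟩ := exists_nat_pow_near (Real.one_le_rpow hn' (by positivity : 0 ≤ 2 * δ)) hρ
  refine ⟨i + 1, hi'.le, ?_⟩
  generalize hj : i + 1 = j
  have hup : ρ ^ j ≤ ρ * (n : ℝ) ^ (2 * δ) := by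
    rw [← hj, pow_succ']
    gcongr
  have hj1 : (j : ℝ) + 1 ≤ (ρ ^ j) ^ η := by
    calc (j : ℝ) + 1 ≤ 2 ^ j := by exact_mod_cast Nat.lt_two_pow_self
      _ ≤ (ρ ^ η) ^ j := by gcongr
      _ = (ρ ^ j) ^ η := by
          rw [← Real.rpow_natCast, ← Real.rpow_natCast, ← Real.rpow_mul hρ0.le,
            ← Real.rpow_mul hρ0.le, mul_comm]
  have hT : (ρ ^ (D + η) / ρ) ^ j = (ρ ^ j) ^ (D - 1 + η) := by
    rw [← Real.rpow_sub_one hρ0.ne', ← Real.rpow_natCast, ← Real.rpow_natCast,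
      ← Real.rpow_mul hρ0.le, ← Real.rpow_mul hρ0.le]
    congr 1
    ring
  calc (j + 1) * (ρ ^ (D + η) / ρ) ^ j ≤ (ρ ^ j) ^ η * (ρ ^ j) ^ (D - 1 + η) := by
        rw [hT]; gcongr
    _ = (ρ ^ j) ^ (D - 1 + 2 * η) := by
        rw [← Real.rpow_add (by positivity)]
        congr 1
        ring
    _ ≤ (ρ * (n : ℝ) ^ (2 * δ)) ^ (D - 1 + 2 * η) :=
        Real.rpow_le_rpow (by positivity) hup (by linarith)
    _ = ρ ^ (D - 1 + 2 * η) * (n : ℝ) ^ (1 / 2 - δ) := by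
        rw [Real.mul_rpow hρ0.le (by positivity), ← Real.rpow_mul hn0, hδη]

theorem stmt1 {U V : Type*} (E : Set (U × V)) (s : ℕ) (hs : 1 ≤ s)
    (D : ℝ) (hD : 1 ≤ D) (hfree : KstFree E s 2) (hcut : AdmitsCuttings E D)
    (δ : ℝ) (hδ0 : 0 < δ) (hδ1 : δ < 1 / (2 * (2 * D - 1))) :
    ∃ C : ℝ, 0 < C ∧
      ∀ (n : ℕ) (A : Set U) (B : Set V), A.Finite → B.Finite →
        A.ncard ≤ n → B.ncard ≤ n →
        ((E ∩ A ×ˢ B).ncard : ℝ) ≤ C * (n : ℝ) ^ ((3 : ℝ) / 2 - δ) := by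
  classical
  obtain ⟨c₀, hc⟩ := hcut
  have hδ2 : δ * (2 * D - 1) < 1 / 2 := by
    rw [lt_div_iff₀ (by linarith)] at hδ1
    linarith
  have hδhalf : δ < 1 / 2 := by nlinarith
  obtain ⟨η, hη, hδη⟩ : ∃ η : ℝ, 0 < η ∧ 2 * δ * (D - 1 + 2 * η) = 1 / 2 - δ := by
    refine ⟨(1 / 2 - δ * (2 * D - 1)) / (4 * δ), div_pos (by linarith) (by linarith), ?_⟩
    field_simp
    ring
  obtain ⟨ρ, hρ, hρη, hρc⟩ : ∃ ρ : ℝ, 1 < ρ ∧ 2 ≤ ρ ^ η ∧ c₀ * (s : ℝ) ^ D ≤ ρ ^ η := by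
    have h2 : (2 : ℝ) ≤ max 2 (c₀ * (s : ℝ) ^ D) := le_max_left _ _
    refine ⟨(max 2 (c₀ * (s : ℝ) ^ D)) ^ η⁻¹,
      Real.one_lt_rpow (by linarith) (by positivity), ?_, ?_⟩ <;>
    rw [Real.rpow_inv_rpow (by linarith) hη.ne']
    exacts [h2, le_max_right _ _]
  have hρ0 : 0 < ρ := by linarith
  have hρT : ρ ≤ ρ ^ (D + η) := Real.self_le_rpow_of_one_le hρ.le (by linarith)
  have hcT : c₀ * (s * ρ) ^ D ≤ ρ ^ (D + η) := by
    rw [Real.mul_rpow (Nat.cast_nonneg _) hρ0.le, Real.rpow_add hρ0, ← mul_assoc, mul_comm]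
    gcongr
  set X : ℝ := ρ ^ (D - 1 + 2 * η)
  set T : ℝ := ρ ^ (D + η)
  have hX0 : 0 < X := Real.rpow_pos_of_pos hρ0 _
  have hT0 : 0 < T := Real.rpow_pos_of_pos hρ0 _
  refine ⟨1 + √s + s * ρ + s * X + T * X, by positivity, fun n A B hA hB hAn hBn => ?_⟩
  lift A to Finset U using hA
  lift B to Finset V using hB
  rw [Set.ncard_coe_finset] at hAn hBn
  rw [ncard_inter_prod_eq_incidences]
  rcases Nat.eq_zero_or_pos n with rfl | hn
  · have h0 : incidences E A B = 0 := by
      rw [Finset.card_eq_zero.1 (Nat.le_zero.1 hAn), incidences, Finset.sum_empty]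
    rw [h0, Nat.cast_zero]
    positivity
  have hn' : (1 : ℝ) ≤ n := by exact_mod_cast hn
  have hn0 : (0 : ℝ) < n := by linarith
  have hAn' : (A.card : ℝ) ≤ n := by exact_mod_cast hAn
  have hBn' : (B.card : ℝ) ≤ n := by exact_mod_cast hBn
  obtain ⟨j, hj, hjX⟩ := exists_depth hD hδ0 hη hδη hρ hρη hn
  have hcard : ((A.filter fun a => (fiber E a).Nontrivial).card : ℝ) ≤ n :=
    (Nat.cast_le.2 (Finset.card_filter_le _ _)).trans hAn'
  have hrec := hfree.incidences_le_of_cuttings (R := s * ρ) (by positivity) hρ hρT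
    (fun A' hA' hlt => by
      obtain ⟨t, Vs, h1, h2, h3⟩ := hfree.exists_cutting hs hc hρ A' hA' hlt
      exact ⟨t, Vs, h1, h2.trans hcT, h3⟩)
    j (A.filter fun a => (fiber E a).Nontrivial) B
    (fun a ha => (Finset.mem_filter.1 ha).2) hcard
  have hsplit : (incidences E A B : ℝ) ≤
      A.card + incidences E (A.filter fun a => (fiber E a).Nontrivial) B := by
    exact_mod_cast incidences_le_card_add_nontrivial A B
  set Y : ℝ := (n : ℝ) ^ (1 / 2 - δ) with hY
  have hY1 : 1 ≤ Y := Real.one_le_rpow hn' (by linarith)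
  have hYn : (n : ℝ) ^ ((3 : ℝ) / 2 - δ) = n * Y := by
    rw [hY, ← Real.rpow_one_add' hn0.le (by linarith)]
    congr 1
    ring
  have hsqrt : √(s * (n / ρ ^ j)) ≤ √s * Y := by
    rw [Real.sqrt_mul (Nat.cast_nonneg _)]
    gcongr
    rw [Real.sqrt_le_left (by positivity), div_le_iff₀ (by positivity)]
    calc (n : ℝ) = Y ^ 2 * (n : ℝ) ^ (2 * δ) := by
          rw [hY, ← Real.rpow_natCast, ← Real.rpow_mul hn0.le, ← Real.rpow_add hn0]
          conv_lhs => rw [← Real.rpow_one (n : ℝ)]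
          congr 1
          push_cast
          ring
      _ ≤ Y ^ 2 * ρ ^ j := by gcongr
  have hjY : (j : ℝ) ≤ X * Y := by
    have h1 : (1 : ℝ) ≤ (T / ρ) ^ j := one_le_pow₀ ((one_le_div hρ0).2 hρT)
    have h2 : (0 : ℝ) ≤ j := Nat.cast_nonneg _
    nlinarith
  rw [hYn]
  calc (incidences E A B : ℝ)
      ≤ n + (√(s * (n / ρ ^ j)) * B.card + (s * ρ + j * s) * B.card +
          (j + 1) * T * (T / ρ) ^ j * n) := by linarith
    _ = n * 1 + (√(s * (n / ρ ^ j)) * B.card + (s * ρ * 1 + j * s) * B.card +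
          T * ((j + 1) * (T / ρ) ^ j) * n) := by ring
    _ ≤ n * Y + ((√s * Y) * n + (s * ρ * Y + (X * Y) * s) * n + T * (X * Y) * n) := by
        gcongr
    _ = (1 + √s + s * ρ + s * X + T * X) * (n * Y) := by ring
end

section
/- Let X, Y, Z be sets, d ∈ ℕ, and let F ⊆ X × Y × Z be Δ-algebraic with bound d. Define G from F as below. Then: (i) for every pair (b₁,b₂) ∈ Y × Y and every finite set C ⊆ Z, |G ∩ ({(b₁,b₂)} × (C × C))| ≤ d²·|C|; and (ii) for every pair (c₁,c₂) ∈ Z × Z and every finite set B ⊆ Y, |G ∩ ((B × B) × {(c₁,c₂)})| ≤ d²·|B|. -/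
open Set

/-- `F ⊆ X × Y × Z` is Δ-algebraic with bound `d`. -/
def DeltaAlgebraic {X Y Z : Type*} (F : Set (X × Y × Z)) (d : ℕ) : Prop :=
  (∀ (a : X) (b : Y), {z : Z | (a, b, z) ∈ F}.encard ≤ d) ∧
  (∀ (a : X) (c : Z), {y : Y | (a, y, c) ∈ F}.encard ≤ d) ∧
  (∀ (b : Y) (c : Z), {x : X | (x, b, c) ∈ F}.encard ≤ d)

/-- The relation `G ⊆ (Y × Y) × (Z × Z)` associated to `F`. -/
def Gset {X Y Z : Type*} (F : Set (X × Y × Z)) : Set ((Y × Y) × (Z × Z)) :=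
  {p | ∃ x : X, (x, p.1.1, p.2.1) ∈ F ∧ (x, p.1.2, p.2.2) ∈ F}

theorem encard_biUnion_le_mul_encard {α β : Type*} {s : Set α} (hs : s.Finite)
    (t : α → Set β) (n : ℕ∞) (ht : ∀ a ∈ s, (t a).encard ≤ n) :
    (⋃ a ∈ s, t a).encard ≤ n * s.encard := by
  induction s, hs using Set.Finite.induction_on with
  | empty => simp
  | @insert a s ha _ ih =>
    rw [biUnion_insert, encard_insert_of_notMem ha, mul_add, mul_one, add_comm]
    exact (encard_union_le _ _).trans
      (add_le_add (ht a (mem_insert a s)) (ih fun b hb => ht b (mem_insert_of_mem a hb)))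

/-- If every `c` has at most `d` preimages under `R` and every `x` has at most `d` images
under `S`, then the composite relation has at most `d ^ 2 * |C|` pairs with first entry in `C`. -/
theorem encard_comp_le {X Z W : Type*} (R : X → Z → Prop) (S : X → W → Prop) (d : ℕ)
    (hR : ∀ c, {x | R x c}.encard ≤ d) (hS : ∀ x, {w | S x w}.encard ≤ d)
    {C : Set Z} (hC : C.Finite) :
    {p : Z × W | p.1 ∈ C ∧ ∃ x, R x p.1 ∧ S x p.2}.encard ≤ ((d ^ 2 * C.ncard : ℕ) : ℕ∞) := by
  have hsub : {p : Z × W | p.1 ∈ C ∧ ∃ x, R x p.1 ∧ S x p.2} ⊆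
      ⋃ c ∈ C, Prod.mk c '' ⋃ x ∈ {x | R x c}, {w | S x w} := by
    rintro ⟨c, w⟩ ⟨hc, x, hx, hw⟩
    exact mem_biUnion hc ⟨w, mem_biUnion (show x ∈ {x | R x c} from hx) hw, rfl⟩
  have hfiber : ∀ c ∈ C,
      (Prod.mk c '' ⋃ x ∈ {x | R x c}, {w | S x w}).encard ≤ (d : ℕ∞) ^ 2 := by
    intro c _
    have hfin : {x | R x c}.Finite := finite_of_encard_le_coe (hR c)
    calc (Prod.mk c '' ⋃ x ∈ {x | R x c}, {w | S x w}).encard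
        ≤ (⋃ x ∈ {x | R x c}, {w | S x w}).encard := encard_image_le _ _
      _ ≤ d * {x | R x c}.encard := encard_biUnion_le_mul_encard hfin _ _ fun x _ => hS x
      _ ≤ d * d := by gcongr; exact hR c
      _ = (d : ℕ∞) ^ 2 := (sq _).symm
  calc _ ≤ _ := encard_le_encard hsub
    _ ≤ (d : ℕ∞) ^ 2 * C.encard := encard_biUnion_le_mul_encard hC _ _ hfiber
    _ = ((d ^ 2 * C.ncard : ℕ) : ℕ∞) := by
      rw [← hC.cast_ncard_eq]; push_cast; rfl

theorem stmt3 {X Y Z : Type*} (F : Set (X × Y × Z)) (d : ℕ)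
    (hF : DeltaAlgebraic F d) :
    (∀ (b₁ b₂ : Y) (C : Set Z), C.Finite →
        (Gset F ∩ ({(b₁, b₂)} ×ˢ (C ×ˢ C))).encard ≤ ((d ^ 2 * C.ncard : ℕ) : ℕ∞)) ∧
    (∀ (c₁ c₂ : Z) (B : Set Y), B.Finite →
        (Gset F ∩ ((B ×ˢ B) ×ˢ {(c₁, c₂)})).encard ≤ ((d ^ 2 * B.ncard : ℕ) : ℕ∞)) := by
  obtain ⟨hZ, hY, hX⟩ := hF
  constructor
  · intro b₁ b₂ C hC
    refine le_trans ?_ (encard_comp_le (fun x z => (x, b₁, z) ∈ F) (fun x z => (x, b₂, z) ∈ F) d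
      (hX b₁) (fun x => hZ x b₂) hC)
    refine (encard_le_encard ?_).trans (encard_image_le (Prod.mk (b₁, b₂)) _)
    rintro ⟨⟨y, y'⟩, z, z'⟩ ⟨⟨x, h, h'⟩, hy, hz, -⟩
    obtain ⟨rfl, rfl⟩ := Prod.mk.inj hy
    exact ⟨(z, z'), ⟨hz, x, h, h'⟩, rfl⟩
  · intro c₁ c₂ B hB
    refine le_trans ?_ (encard_comp_le (fun x y => (x, y, c₁) ∈ F) (fun x y => (x, y, c₂) ∈ F) d
      (fun y => hX y c₁) (fun x => hY x c₂) hB)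
    refine (encard_le_encard ?_).trans (encard_image_le (fun p => (p, (c₁, c₂))) _)
    rintro ⟨⟨y, y'⟩, z, z'⟩ ⟨⟨x, h, h'⟩, ⟨hy, -⟩, hz⟩
    obtain ⟨rfl, rfl⟩ := Prod.mk.inj hz
    exact ⟨(y, y'), ⟨hy, x, h, h'⟩, rfl⟩
end

section
/- Let X, Y, Z be sets, d ∈ ℕ, and let F ⊆ X × Y × Z be Δ-algebraic with bound d. Define G from F as below. Then for all finite sets A ⊆ X, B ⊆ Y, C ⊆ Z, writing F' = F ∩ (A × B × C) and G' = G ∩ ((B × B) × (C × C)), one has |F'| ≤ d·|A|^{1/2}·|G'|^{1/2}. -/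
open Set

/-- Cauchy–Schwarz for the fibres of `g : s → t`: the square of `#s` is at most `#t` times the
number of pairs lying in a common fibre. -/
theorem Finset.sq_card_le_card_mul_card_filter_eq {α β : Type*} [DecidableEq β] (s : Finset α)
    (t : Finset β) (g : α → β) (hg : ∀ a ∈ s, g a ∈ t) :
    s.card ^ 2 ≤ t.card * ((s ×ˢ s).filter fun p => g p.1 = g p.2).card := by
  have hpairs : ((s ×ˢ s).filter fun p => g p.1 = g p.2).card =
      ∑ b ∈ t, (s.filter fun a => g a = b).card ^ 2 := by
    rw [Finset.card_eq_sum_card_fiberwise (f := fun p => g p.1) (t := t)]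
    · refine Finset.sum_congr rfl fun b _ => ?_
      rw [sq, ← Finset.card_product]
      congr 1
      ext p
      simp only [Finset.mem_filter, Finset.mem_product]
      grind
    · intro p hp
      simp only [Finset.coe_filter, Finset.mem_product, Set.mem_ofPred_eq] at hp
      exact hg _ hp.1.1
  rw [hpairs, Finset.card_eq_sum_card_fiberwise (f := g) (t := t) hg]
  exact sq_sum_le_card_mul_sum_sq

/-- Pairs of points of `F` over a common `x` project to `Gset F` with fibres of size at most `d`. -/
theorem DeltaAlgebraic.sq_ncard_le {X Y Z : Type*} {F : Set (X × Y × Z)} {d : ℕ}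
    (hF : DeltaAlgebraic F d) {A : Set X} {B : Set Y} {C : Set Z}
    (hA : A.Finite) (hB : B.Finite) (hC : C.Finite) :
    (F ∩ (A ×ˢ (B ×ˢ C))).ncard ^ 2 ≤
      A.ncard * (d * (Gset F ∩ ((B ×ˢ B) ×ˢ (C ×ˢ C))).ncard) := by
  classical
  have hfin : (F ∩ (A ×ˢ (B ×ˢ C))).Finite := (hA.prod (hB.prod hC)).inter_of_right _
  have hGfin : (Gset F ∩ ((B ×ˢ B) ×ˢ (C ×ˢ C))).Finite :=
    ((hB.prod hB).prod (hC.prod hC)).inter_of_right _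
  rw [Set.ncard_eq_toFinset_card _ hfin, Set.ncard_eq_toFinset_card _ hA,
    Set.ncard_eq_toFinset_card _ hGfin]
  refine (Finset.sq_card_le_card_mul_card_filter_eq _ hA.toFinset Prod.fst ?_).trans
    (Nat.mul_le_mul_left _ ?_)
  · intro p hp
    simp only [Set.Finite.mem_toFinset] at hp ⊢
    exact hp.2.1
  refine Finset.card_le_mul_card_image_of_maps_to
    (f := fun p => ((p.1.2.1, p.2.2.1), (p.1.2.2, p.2.2.2))) ?_ d ?_
  · rintro ⟨⟨x, y, z⟩, ⟨x', y', z'⟩⟩ hp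
    simp only [Finset.mem_filter, Finset.mem_product, Set.Finite.mem_toFinset] at hp ⊢
    obtain ⟨⟨⟨h, -, hy, hz⟩, ⟨h', -, hy', hz'⟩⟩, rfl⟩ := hp
    exact ⟨⟨x, h, h'⟩, ⟨hy, hy'⟩, ⟨hz, hz'⟩⟩
  · rintro ⟨⟨y, y'⟩, ⟨z, z'⟩⟩ -
    have hle := hF.2.2 y z
    rw [← Nat.cast_le (α := ℕ∞), ← Set.encard_coe_eq_coe_finsetCard]
    refine (Set.encard_le_encard_of_injOn (f := fun p => p.1.1) ?_ ?_).trans hle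
    · rintro ⟨⟨x, u, v⟩, ⟨x', u', v'⟩⟩ hp
      simp only [Finset.coe_filter, Finset.mem_filter, Finset.mem_product,
        Set.Finite.mem_toFinset, Set.mem_ofPred_eq, Prod.mk.injEq] at hp ⊢
      obtain ⟨⟨⟨h, -⟩, -⟩, ⟨rfl, -⟩, ⟨rfl, -⟩⟩ := hp
      exact h.1
    · rintro ⟨⟨x, u, v⟩, ⟨x', u', v'⟩⟩ hp ⟨⟨a, b, c⟩, ⟨a', b', c'⟩⟩ hq hpq
      simp only [Finset.coe_filter, Finset.mem_filter, Set.mem_ofPred_eq, Prod.mk.injEq]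
        at hp hq hpq ⊢
      grind

theorem stmt4 {X Y Z : Type*} (F : Set (X × Y × Z)) (d : ℕ)
    (hF : DeltaAlgebraic F d)
    (A : Set X) (B : Set Y) (C : Set Z) (hA : A.Finite) (hB : B.Finite) (hC : C.Finite) :
    (((F ∩ (A ×ˢ (B ×ˢ C))).ncard : ℝ)) ≤
      (d : ℝ) * (A.ncard : ℝ) ^ ((1 : ℝ) / 2) *
        ((Gset F ∩ ((B ×ˢ B) ×ˢ (C ×ˢ C))).ncard : ℝ) ^ ((1 : ℝ) / 2) := by
  have hsq : ((F ∩ (A ×ˢ (B ×ˢ C))).ncard : ℝ) ^ 2 ≤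
      A.ncard * (d * (Gset F ∩ ((B ×ˢ B) ×ˢ (C ×ˢ C))).ncard) := by
    exact_mod_cast hF.sq_ncard_le hA hB hC
  have hd : (d : ℝ) ≤ d ^ 2 := by exact_mod_cast Nat.le_self_pow two_ne_zero d
  rw [← Real.sqrt_eq_rpow, ← Real.sqrt_eq_rpow]
  refine (sq_le_sq₀ (by positivity) (by positivity)).mp ?_
  rw [mul_pow, mul_pow, Real.sq_sqrt (by positivity), Real.sq_sqrt (by positivity)]
  calc _ ≤ _ := hsq
    _ = d * (A.ncard * (Gset F ∩ ((B ×ˢ B) ×ˢ (C ×ˢ C))).ncard : ℝ) := by ring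
    _ ≤ d ^ 2 * (A.ncard * (Gset F ∩ ((B ×ˢ B) ×ˢ (C ×ˢ C))).ncard : ℝ) := by gcongr
    _ = _ := by ring
end

section
/- Let X, Y, Z be sets, d ∈ ℕ, and let F ⊆ X × Y × Z be such that for all b ∈ Y, c ∈ Z the set {x ∈ X : (x,b,c) ∈ F} has at most d elements. Define G from F as below. Then for all finite sets A ⊆ X, B ⊆ Y, C ⊆ Z, writing W' = {(x,y,y',z,z') ∈ A × B × B × C × C : (x,y,z) ∈ F and (x,y',z') ∈ F} and G' = G ∩ ((B × B) × (C × C)), one has |W'| ≤ d·|G'|. -/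
open Set

theorem stmt6 {X Y Z : Type*} (F : Set (X × Y × Z)) (d : ℕ)
    (hd : ∀ (b : Y) (c : Z), {x : X | (x, b, c) ∈ F}.encard ≤ d)
    (A : Set X) (B : Set Y) (C : Set Z) (hA : A.Finite) (hB : B.Finite) (hC : C.Finite) :
    ({p : X × Y × Y × Z × Z |
        p.1 ∈ A ∧ p.2.1 ∈ B ∧ p.2.2.1 ∈ B ∧ p.2.2.2.1 ∈ C ∧ p.2.2.2.2 ∈ C ∧
        (p.1, p.2.1, p.2.2.2.1) ∈ F ∧ (p.1, p.2.2.1, p.2.2.2.2) ∈ F}).ncard ≤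
      d * (Gset F ∩ ((B ×ˢ B) ×ˢ (C ×ˢ C))).ncard := by
  classical
  set W := {p : X × Y × Y × Z × Z |
        p.1 ∈ A ∧ p.2.1 ∈ B ∧ p.2.2.1 ∈ B ∧ p.2.2.2.1 ∈ C ∧ p.2.2.2.2 ∈ C ∧
        (p.1, p.2.1, p.2.2.2.1) ∈ F ∧ (p.1, p.2.2.1, p.2.2.2.2) ∈ F} with hW
  have hWfin : W.Finite :=
    (hA.prod (hB.prod (hB.prod (hC.prod hC)))).subset
      fun p hp => ⟨hp.1, hp.2.1, hp.2.2.1, hp.2.2.2.1, hp.2.2.2.2.1⟩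
  have hGfin : (Gset F ∩ ((B ×ˢ B) ×ˢ (C ×ˢ C))).Finite :=
    ((hB.prod hB).prod (hC.prod hC)).subset inter_subset_right
  rw [ncard_eq_toFinset_card _ hWfin, ncard_eq_toFinset_card _ hGfin]
  refine Finset.card_le_mul_card_image_of_maps_to
    (f := fun p : X × Y × Y × Z × Z => ((p.2.1, p.2.2.1), (p.2.2.2.1, p.2.2.2.2))) ?_ d ?_
  · intro p hp
    obtain ⟨-, hy, hy', hz, hz', h, h'⟩ := hWfin.mem_toFinset.1 hp
    exact hGfin.mem_toFinset.2 ⟨⟨p.1, h, h'⟩, ⟨hy, hy'⟩, ⟨hz, hz'⟩⟩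
  · rintro ⟨⟨y, y'⟩, ⟨z, z'⟩⟩ -
    rw [← Nat.cast_le (α := ℕ∞), ← encard_coe_eq_coe_finsetCard]
    refine (encard_le_encard_of_injOn (f := Prod.fst) ?_ ?_).trans (hd y z)
    · rintro ⟨x, a, a', c, c'⟩ hp
      simp only [Finset.coe_filter, Finite.mem_toFinset, hW, mem_ofPred_eq, Prod.mk.injEq] at hp
      obtain ⟨⟨-, -, -, -, -, h, -⟩, ⟨rfl, -⟩, rfl, -⟩ := hp
      exact h
    · rintro ⟨x, a, a', c, c'⟩ hp ⟨x₁, a₁, a₁', c₁, c₁'⟩ hq hx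
      simp only [Finset.coe_filter, mem_ofPred_eq, Prod.mk.injEq] at hp hq hx ⊢
      grind
end

section
/- Let X, Y, Z be sets, d ∈ ℕ, and let F ⊆ X × Y × Z be Δ-algebraic with bound d. Define G from F as below. Suppose there are sets Y₀ ⊆ Y × Y, Z₀ ⊆ Z × Z and constants k₁, k₂ ∈ ℕ such that |(B × B) ∩ Y₀| ≤ k₁·|B| for every finite B ⊆ Y and |(C × C) ∩ Z₀| ≤ k₂·|C| for every finite C ⊆ Z. Suppose further there are c₀ > 0 and δ > 0 such that for every m ∈ ℕ and all B' ⊆ (Y × Y) ∖ Y₀, C' ⊆ (Z × Z) ∖ Z₀ with |B'| ≤ m, |C'| ≤ m, one has |G ∩ (B' × C')| ≤ c₀·m^{3/2−δ}. Then there are c₁ > 0 and ε > 0 such that for every n ∈ ℕ and all finite B ⊆ Y, C ⊆ Z with |B| ≤ n, |C| ≤ n, one has |G ∩ ((B × B) × (C × C))| ≤ c₁·n^{3−ε}. -/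
open Set

theorem Set.encard_biUnion_le_of_forall_le {α β : Type*} {t : Set β} (ht : t.Finite)
    {R : β → Set α} {k : ℕ∞} (hR : ∀ b ∈ t, (R b).encard ≤ k) :
    (⋃ b ∈ t, R b).encard ≤ t.encard * k := by
  induction t, ht using Set.Finite.induction_on with
  | empty => simp
  | @insert a s ha hs ih =>
    rw [biUnion_insert, encard_insert_of_notMem ha, add_mul, one_mul, add_comm]
    exact (encard_union_le _ _).trans (add_le_add (hR a (mem_insert a s))
      (ih fun b hb => hR b (mem_insert_of_mem a hb)))

theorem Set.ncard_le_of_encard_le_natCast {α : Type*} {s : Set α} {n : ℕ}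
    (h : s.encard ≤ n) : s.ncard ≤ n := by
  rw [← (finite_of_encard_le_coe h).cast_ncard_eq] at h
  exact_mod_cast h

/-- Few pairs on the `Y` side produce few elements of `Gset F`. -/
theorem DeltaAlgebraic.ncard_Gset_inter_prod_left_le {X Y Z : Type*} {F : Set (X × Y × Z)} {d : ℕ}
    (hF : DeltaAlgebraic F d) {P : Set (Y × Y)} {C : Set Z} (hP : P.Finite) (hC : C.Finite) :
    (Gset F ∩ (P ×ˢ (C ×ˢ C))).ncard ≤ P.ncard * (C.ncard * (d * d)) := by
  have hsub : Gset F ∩ (P ×ˢ (C ×ˢ C)) ⊆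
      ⋃ p ∈ P, ⋃ z ∈ C, ⋃ x ∈ {x | (x, p.1, z) ∈ F},
        (fun z' => (p, (z, z'))) '' {z' | (x, p.2, z') ∈ F} := by
    rintro ⟨p, z, z'⟩ ⟨⟨x, h₁, h₂⟩, hp, hz, -⟩
    simp only [mem_iUnion]
    exact ⟨p, hp, z, hz, x, h₁, z', h₂, rfl⟩
  refine ncard_le_of_encard_le_natCast ((encard_le_encard hsub).trans ?_)
  push_cast
  rw [hP.cast_ncard_eq, hC.cast_ncard_eq]
  refine encard_biUnion_le_of_forall_le hP fun p _ =>
    encard_biUnion_le_of_forall_le hC fun z _ => ?_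
  refine (encard_biUnion_le_of_forall_le (finite_of_encard_le_coe (hF.2.2 _ _)) fun x _ =>
    (encard_image_le _ _).trans (hF.1 _ _)).trans ?_
  gcongr
  exact hF.2.2 _ _

/-- Few pairs on the `Z` side produce few elements of `Gset F`. -/
theorem DeltaAlgebraic.ncard_Gset_inter_prod_right_le {X Y Z : Type*} {F : Set (X × Y × Z)} {d : ℕ}
    (hF : DeltaAlgebraic F d) {B : Set Y} {Q : Set (Z × Z)} (hB : B.Finite) (hQ : Q.Finite) :
    (Gset F ∩ ((B ×ˢ B) ×ˢ Q)).ncard ≤ Q.ncard * (B.ncard * (d * d)) := by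
  have hsub : Gset F ∩ ((B ×ˢ B) ×ˢ Q) ⊆
      ⋃ q ∈ Q, ⋃ y ∈ B, ⋃ x ∈ {x | (x, y, q.1) ∈ F},
        (fun y' => ((y, y'), q)) '' {y' | (x, y', q.2) ∈ F} := by
    rintro ⟨⟨y, y'⟩, q⟩ ⟨⟨x, h₁, h₂⟩, ⟨hy, -⟩, hq⟩
    simp only [mem_iUnion]
    exact ⟨q, hq, y, hy, x, h₁, y', h₂, rfl⟩
  refine ncard_le_of_encard_le_natCast ((encard_le_encard hsub).trans ?_)
  push_cast
  rw [hQ.cast_ncard_eq, hB.cast_ncard_eq]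
  refine encard_biUnion_le_of_forall_le hQ fun q _ =>
    encard_biUnion_le_of_forall_le hB fun y _ => ?_
  refine (encard_biUnion_le_of_forall_le (finite_of_encard_le_coe (hF.2.2 _ _)) fun x _ =>
    (encard_image_le _ _).trans (hF.2.1 _ _)).trans ?_
  gcongr
  exact hF.2.2 _ _

theorem stmt7 {X Y Z : Type*} (F : Set (X × Y × Z)) (d : ℕ)
    (hF : DeltaAlgebraic F d)
    (Y₀ : Set (Y × Y)) (Z₀ : Set (Z × Z)) (k₁ k₂ : ℕ)
    (hY₀ : ∀ B : Set Y, B.Finite → ((B ×ˢ B) ∩ Y₀).ncard ≤ k₁ * B.ncard)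
    (hZ₀ : ∀ C : Set Z, C.Finite → ((C ×ˢ C) ∩ Z₀).ncard ≤ k₂ * C.ncard)
    (c₀ δ : ℝ) (hc₀ : 0 < c₀) (hδ : 0 < δ)
    (hbound : ∀ (m : ℕ) (B' : Set (Y × Y)) (C' : Set (Z × Z)),
      B' ⊆ Y₀ᶜ → C' ⊆ Z₀ᶜ → B'.Finite → C'.Finite → B'.ncard ≤ m → C'.ncard ≤ m →
      ((Gset F ∩ (B' ×ˢ C')).ncard : ℝ) ≤ c₀ * (m : ℝ) ^ ((3 : ℝ) / 2 - δ)) :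
    ∃ c₁ : ℝ, 0 < c₁ ∧ ∃ ε : ℝ, 0 < ε ∧
      ∀ (n : ℕ) (B : Set Y) (C : Set Z), B.Finite → C.Finite →
        B.ncard ≤ n → C.ncard ≤ n →
        ((Gset F ∩ ((B ×ˢ B) ×ˢ (C ×ˢ C))).ncard : ℝ) ≤ c₁ * (n : ℝ) ^ ((3 : ℝ) - ε) := by
  refine ⟨k₁ * (d * d) + k₂ * (d * d) + c₀, by positivity, min (2 * δ) 1,
    lt_min (by positivity) one_pos, fun n B C hB hC hBn hCn => ?_⟩
  rcases Nat.eq_zero_or_pos n with rfl | hn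
  · have hB' : B = ∅ := (ncard_eq_zero hB).1 (Nat.le_zero.1 hBn)
    subst hB'
    simp only [empty_prod, inter_empty, ncard_empty, Nat.cast_zero]
    positivity
  have hBB := hB.prod hB
  have hCC := hC.prod hC
  have hsub : Gset F ∩ ((B ×ˢ B) ×ˢ (C ×ˢ C)) ⊆
      (Gset F ∩ (((B ×ˢ B) ∩ Y₀) ×ˢ (C ×ˢ C)) ∪ Gset F ∩ ((B ×ˢ B) ×ˢ ((C ×ˢ C) ∩ Z₀))) ∪
        Gset F ∩ (((B ×ˢ B) \ Y₀) ×ˢ ((C ×ˢ C) \ Z₀)) := by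
    rintro ⟨p, q⟩ ⟨hG, hp, hq⟩
    by_cases hpY : p ∈ Y₀
    · exact .inl (.inl ⟨hG, ⟨hp, hpY⟩, hq⟩)
    by_cases hqZ : q ∈ Z₀
    · exact .inl (.inr ⟨hG, hp, ⟨hq, hqZ⟩⟩)
    · exact .inr ⟨hG, ⟨hp, hpY⟩, ⟨hq, hqZ⟩⟩
  have hfin : ((Gset F ∩ (((B ×ˢ B) ∩ Y₀) ×ˢ (C ×ˢ C)) ∪
      Gset F ∩ ((B ×ˢ B) ×ˢ ((C ×ˢ C) ∩ Z₀))) ∪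
        Gset F ∩ (((B ×ˢ B) \ Y₀) ×ˢ ((C ×ˢ C) \ Z₀))).Finite := by
    refine (hBB.prod hCC).subset ?_
    rintro ⟨p, q⟩ ((⟨-, hp, hq⟩ | ⟨-, hp, hq⟩) | ⟨-, hp, hq⟩)
    exacts [⟨hp.1, hq⟩, ⟨hp, hq.1⟩, ⟨hp.1, hq.1⟩]
  have hsum := (ncard_le_ncard hsub hfin).trans ((ncard_union_le _ _).trans
    (Nat.add_le_add_right (ncard_union_le _ _) _))
  have hY : (Gset F ∩ (((B ×ˢ B) ∩ Y₀) ×ˢ (C ×ˢ C))).ncard ≤ k₁ * n * (n * (d * d)) :=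
    (hF.ncard_Gset_inter_prod_left_le (hBB.inter_of_left _) hC).trans (by
      gcongr
      exact (hY₀ B hB).trans (by gcongr))
  have hZ : (Gset F ∩ ((B ×ˢ B) ×ˢ ((C ×ˢ C) ∩ Z₀))).ncard ≤ k₂ * n * (n * (d * d)) :=
    (hF.ncard_Gset_inter_prod_right_le hB (hCC.inter_of_left _)).trans (by
      gcongr
      exact (hZ₀ C hC).trans (by gcongr))
  have hmain := hbound (n * n) ((B ×ˢ B) \ Y₀) ((C ×ˢ C) \ Z₀) (fun _ h => h.2) (fun _ h => h.2)
    hBB.sdiff hCC.sdiff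
    ((ncard_le_ncard sdiff_subset hBB).trans (by rw [ncard_prod]; gcongr))
    ((ncard_le_ncard sdiff_subset hCC).trans (by rw [ncard_prod]; gcongr))
  have hn1 : (1 : ℝ) ≤ n := by exact_mod_cast hn
  have hsq : (n : ℝ) * n ≤ (n : ℝ) ^ ((3 : ℝ) - min (2 * δ) 1) := by
    rw [← pow_two, ← Real.rpow_natCast]
    refine Real.rpow_le_rpow_of_exponent_le hn1 ?_
    have := min_le_right (2 * δ) 1
    push_cast
    linarith
  have hpow : ((n * n : ℕ) : ℝ) ^ ((3 : ℝ) / 2 - δ) ≤ (n : ℝ) ^ ((3 : ℝ) - min (2 * δ) 1) := by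
    rw [Nat.cast_mul, ← pow_two, ← Real.rpow_natCast, ← Real.rpow_mul (Nat.cast_nonneg n)]
    refine Real.rpow_le_rpow_of_exponent_le hn1 ?_
    have := min_le_left (2 * δ) 1
    push_cast
    linarith
  calc ((Gset F ∩ ((B ×ˢ B) ×ˢ (C ×ˢ C))).ncard : ℝ)
      ≤ (k₁ * n * (n * (d * d)) + k₂ * n * (n * (d * d)) : ℕ) +
          c₀ * ((n * n : ℕ) : ℝ) ^ ((3 : ℝ) / 2 - δ) := by
        refine (Nat.cast_le.2 hsum).trans ?_
        rw [Nat.cast_add]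
        exact add_le_add (Nat.cast_le.2 (add_le_add hY hZ)) hmain
    _ = (k₁ * (d * d) + k₂ * (d * d)) * ((n : ℝ) * n) +
          c₀ * ((n * n : ℕ) : ℝ) ^ ((3 : ℝ) / 2 - δ) := by
        push_cast
        ring
    _ ≤ (k₁ * (d * d) + k₂ * (d * d)) * (n : ℝ) ^ ((3 : ℝ) - min (2 * δ) 1) +
          c₀ * (n : ℝ) ^ ((3 : ℝ) - min (2 * δ) 1) := by
        gcongr
    _ = (k₁ * (d * d) + k₂ * (d * d) + c₀) * (n : ℝ) ^ ((3 : ℝ) - min (2 * δ) 1) := by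
        ring
end

section
/- Let X, Y, Z be sets, d ∈ ℕ, and let F ⊆ X × Y × Z be Δ-algebraic with bound d. Define G from F as below. Suppose there are sets Y₀ ⊆ Y × Y, Z₀ ⊆ Z × Z and constants k₁, k₂ ∈ ℕ such that |(B × B) ∩ Y₀| ≤ k₁·|B| for every finite B ⊆ Y and |(C × C) ∩ Z₀| ≤ k₂·|C| for every finite C ⊆ Z. Suppose further there are c₀ > 0 and δ > 0 such that for every m ∈ ℕ and all B' ⊆ (Y × Y) ∖ Y₀, C' ⊆ (Z × Z) ∖ Z₀ with |B'| ≤ m, |C'| ≤ m, one has |G ∩ (B' × C')| ≤ c₀·m^{3/2−δ}. Then there are c > 0 and ε > 0 such that for every n ∈ ℕ and all finite A ⊆ X, B ⊆ Y, C ⊆ Z with |A| ≤ n, |B| ≤ n, |C| ≤ n, one has |F ∩ (A × B × C)| ≤ c·n^{2−ε}. -/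
open Set

open Finset in
/-- The Cauchy–Schwarz inequality for the fibers of a map `f : s → t`, where `∑ |fiber|²` is
written as the number of pairs with equal image. -/
lemma card_sq_le_card_mul_card_filter_eq {α β : Type*} [DecidableEq β] (s : Finset α)
    (t : Finset β) (f : α → β) (h : ∀ x ∈ s, f x ∈ t) :
    #s ^ 2 ≤ #t * #{p ∈ s ×ˢ s | f p.1 = f p.2} := by
  have hpairs : #{p ∈ s ×ˢ s | f p.1 = f p.2} = ∑ b ∈ t, #{x ∈ s | f x = b} ^ 2 := by
    rw [card_eq_sum_card_fiberwise (f := fun p => f p.1) (t := t)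
      (fun p hp => h _ (by simp at hp; exact hp.1.1))]
    refine sum_congr rfl fun b _ => ?_
    rw [sq, ← card_product]
    congr 1
    ext p
    simp only [mem_filter, mem_product]
    grind
  rw [hpairs, card_eq_sum_card_fiberwise (f := f) (t := t) h]
  exact sq_sum_le_card_mul_sum_sq

/-- A uniform bound on `encard` yields a family of finsets with the same members. -/
lemma exists_finset_of_encard_le {ι α : Type*} {S : ι → Set α} {d : ℕ}
    (h : ∀ i, (S i).encard ≤ d) :
    ∃ T : ι → Finset α, (∀ i x, x ∈ T i ↔ x ∈ S i) ∧ ∀ i, (T i).card ≤ d := by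
  have hfin : ∀ i, (S i).Finite := fun i => Set.finite_of_encard_le_coe (h i)
  refine ⟨fun i => (hfin i).toFinset, by simp, fun i => ?_⟩
  have := h i
  rw [(hfin i).encard_eq_coe_toFinset_card] at this
  exact_mod_cast this

open Finset in
/-- Counting pairs of triples over a common first coordinate: `P` bounds the pairs of second
coordinates that occur, and the third coordinate has at most `d` values given the other two. -/
lemma card_pairs_le_of_snd_mem {X Y Z : Type*} {F : Set (X × Y × Z)} {d : ℕ}
    (hF : ∀ a b, {z : Z | (a, b, z) ∈ F}.encard ≤ d) (A : Finset X) (P : Finset (Y × Y))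
    (W : Finset ((X × Y × Z) × (X × Y × Z)))
    (hW : ∀ w ∈ W, w.1 ∈ F ∧ w.2 ∈ F ∧ w.1.1 = w.2.1 ∧ w.1.1 ∈ A ∧ (w.1.2.1, w.2.2.1) ∈ P) :
    #W ≤ d ^ 2 * (#A * #P) := by
  classical
  obtain ⟨S, hS, hSd⟩ := exists_finset_of_encard_le
    (S := fun i : X × Y => {z : Z | (i.1, i.2, z) ∈ F}) (fun i => hF i.1 i.2)
  rw [← card_product]
  refine card_le_mul_card_image_of_maps_to (f := fun w => (w.1.1, (w.1.2.1, w.2.2.1)))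
    (fun w hw => ?_) _ ?_
  · obtain ⟨-, -, -, hA, hP⟩ := hW w hw
    exact mem_product.2 ⟨hA, hP⟩
  · rintro ⟨a, y, y'⟩ -
    calc _ ≤ #((S (a, y) ×ˢ S (a, y')).image fun q => ((a, y, q.1), (a, y', q.2))) := by
          refine card_le_card fun w hw => ?_
          obtain ⟨⟨x, u, z⟩, ⟨x', u', z'⟩⟩ := w
          simp only [mem_filter, Prod.mk.injEq] at hw
          obtain ⟨hw, rfl, rfl, rfl⟩ := hw
          obtain ⟨h₁, h₂, h₃, -, -⟩ := hW _ hw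
          dsimp only at h₁ h₂ h₃
          subst h₃
          simp only [Finset.mem_image, Finset.mem_product, hS]
          exact ⟨(z, z'), ⟨h₁, h₂⟩, rfl⟩
      _ ≤ #(S (a, y) ×ˢ S (a, y')) := card_image_le
      _ ≤ d ^ 2 := by
          rw [card_product, sq]
          exact Nat.mul_le_mul (hSd _) (hSd _)

open Finset in
/-- Counting pairs of triples over a common first coordinate through the relation `Gset F`. -/
lemma card_pairs_le_of_mem_Gset {X Y Z : Type*} {F : Set (X × Y × Z)} {d : ℕ}
    (hF : ∀ b c, {x : X | (x, b, c) ∈ F}.encard ≤ d) (Q : Finset ((Y × Y) × (Z × Z)))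
    (W : Finset ((X × Y × Z) × (X × Y × Z)))
    (hW : ∀ w ∈ W, w.1 ∈ F ∧ w.1.1 = w.2.1 ∧ ((w.1.2.1, w.2.2.1), (w.1.2.2, w.2.2.2)) ∈ Q) :
    #W ≤ d * #Q := by
  classical
  obtain ⟨S, hS, hSd⟩ := exists_finset_of_encard_le
    (S := fun i : Y × Z => {x : X | (x, i.1, i.2) ∈ F}) (fun i => hF i.1 i.2)
  refine card_le_mul_card_image_of_maps_to
    (f := fun w => ((w.1.2.1, w.2.2.1), (w.1.2.2, w.2.2.2))) (fun w hw => (hW w hw).2.2) _ ?_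
  rintro ⟨⟨y, y'⟩, ⟨z, z'⟩⟩ -
  calc _ ≤ #((S (y, z)).image fun x => ((x, y, z), (x, y', z'))) := by
        refine card_le_card fun w hw => ?_
        obtain ⟨⟨x, u, v⟩, ⟨x', u', v'⟩⟩ := w
        simp only [mem_filter, Prod.mk.injEq] at hw
        obtain ⟨hw, ⟨rfl, rfl⟩, rfl, rfl⟩ := hw
        obtain ⟨h₁, h₂, -⟩ := hW _ hw
        dsimp only at h₁ h₂
        subst h₂
        simp only [Finset.mem_image, hS]
        exact ⟨x, h₁, rfl⟩
    _ ≤ #(S (y, z)) := card_image_le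
    _ ≤ d := hSd _

/-- The exponent bookkeeping: a bound `t² ≤ n (a n² + b (n²)^(3/2 - δ))` saves a power of `n`. -/
lemma le_mul_rpow_of_sq_le {n : ℕ} (hn : n ≠ 0) {t a b δ : ℝ} (ha : 0 ≤ a)
    (hb : 0 ≤ b)
    (h : t ^ 2 ≤ n * (a * n ^ 2 + b * ((n ^ 2 : ℕ) : ℝ) ^ ((3 : ℝ) / 2 - δ))) :
    t ≤ (a + b + 1) * (n : ℝ) ^ ((2 : ℝ) - min δ (1 / 2)) := by
  set ε := min δ (1 / 2)
  have hn1 : (1 : ℝ) ≤ n := by exact_mod_cast Nat.one_le_iff_ne_zero.2 hn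
  have hn0 : (0 : ℝ) < n := by linarith
  have hcube : (n : ℝ) * n ^ 2 ≤ (n : ℝ) ^ ((4 : ℝ) - 2 * ε) := by
    rw [← pow_succ', ← Real.rpow_natCast]
    refine Real.rpow_le_rpow_of_exponent_le hn1 ?_
    have : ε ≤ 1 / 2 := min_le_right _ _
    push_cast
    linarith
  have hmain : (n : ℝ) * ((n ^ 2 : ℕ) : ℝ) ^ ((3 : ℝ) / 2 - δ) ≤ (n : ℝ) ^ ((4 : ℝ) - 2 * ε) := by
    rw [Nat.cast_pow, ← Real.rpow_natCast, ← Real.rpow_mul hn0.le]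
    nth_rw 1 [← Real.rpow_one (n : ℝ)]
    rw [← Real.rpow_add hn0]
    refine Real.rpow_le_rpow_of_exponent_le hn1 ?_
    have : ε ≤ δ := min_le_left _ _
    push_cast
    linarith
  have hsq : ((n : ℝ) ^ ((2 : ℝ) - ε)) ^ 2 = (n : ℝ) ^ ((4 : ℝ) - 2 * ε) := by
    rw [← Real.rpow_mul_natCast hn0.le]
    push_cast
    ring_nf
  refine le_of_abs_le (abs_le_of_sq_le_sq ?_ (by positivity))
  rw [mul_pow, hsq]
  have hR : 0 ≤ (n : ℝ) ^ ((4 : ℝ) - 2 * ε) := by positivity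
  calc t ^ 2 ≤ a * (n * n ^ 2) + b * (n * ((n ^ 2 : ℕ) : ℝ) ^ ((3 : ℝ) / 2 - δ)) := by linarith
    _ ≤ a * (n : ℝ) ^ ((4 : ℝ) - 2 * ε) + b * (n : ℝ) ^ ((4 : ℝ) - 2 * ε) := by gcongr
    _ = (a + b) * (n : ℝ) ^ ((4 : ℝ) - 2 * ε) := by ring
    _ ≤ (a + b + 1) ^ 2 * (n : ℝ) ^ ((4 : ℝ) - 2 * ε) := by
        gcongr
        nlinarith

theorem stmt8 {X Y Z : Type*} (F : Set (X × Y × Z)) (d : ℕ)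
    (hF : DeltaAlgebraic F d)
    (Y₀ : Set (Y × Y)) (Z₀ : Set (Z × Z)) (k₁ k₂ : ℕ)
    (hY₀ : ∀ B : Set Y, B.Finite → ((B ×ˢ B) ∩ Y₀).ncard ≤ k₁ * B.ncard)
    (hZ₀ : ∀ C : Set Z, C.Finite → ((C ×ˢ C) ∩ Z₀).ncard ≤ k₂ * C.ncard)
    (c₀ δ : ℝ) (hc₀ : 0 < c₀) (hδ : 0 < δ)
    (hbound : ∀ (m : ℕ) (B' : Set (Y × Y)) (C' : Set (Z × Z)),
      B' ⊆ Y₀ᶜ → C' ⊆ Z₀ᶜ → B'.Finite → C'.Finite → B'.ncard ≤ m → C'.ncard ≤ m →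
      ((Gset F ∩ (B' ×ˢ C')).ncard : ℝ) ≤ c₀ * (m : ℝ) ^ ((3 : ℝ) / 2 - δ)) :
    ∃ c : ℝ, 0 < c ∧ ∃ ε : ℝ, 0 < ε ∧
      ∀ (n : ℕ) (A : Set X) (B : Set Y) (C : Set Z), A.Finite → B.Finite → C.Finite →
        A.ncard ≤ n → B.ncard ≤ n → C.ncard ≤ n →
        ((F ∩ (A ×ˢ (B ×ˢ C))).ncard : ℝ) ≤ c * (n : ℝ) ^ ((2 : ℝ) - ε) := by
  classical
  obtain ⟨hFz, hFy, hFx⟩ := hF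
  refine ⟨((d ^ 2 * (k₁ + k₂) : ℕ) : ℝ) + d * c₀ + 1, by positivity, min δ (1 / 2),
    by positivity, ?_⟩
  intro n A B C hA hB hC hAn hBn hCn
  lift A to Finset X using hA
  lift B to Finset Y using hB
  lift C to Finset Z using hC
  rw [Set.ncard_coe_finset] at hAn hBn hCn
  rcases eq_or_ne n 0 with rfl | hn
  · obtain rfl : A = ∅ := by simpa using hAn
    simp only [Finset.coe_empty, Set.empty_prod, Set.inter_empty, Set.ncard_empty, Nat.cast_zero]
    positivity
  refine le_mul_rpow_of_sq_le hn (by positivity) (by positivity) ?_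
  let T : Finset (X × Y × Z) := {t ∈ A ×ˢ B ×ˢ C | t ∈ F}
  have hT : F ∩ ((A : Set X) ×ˢ ((B : Set Y) ×ˢ (C : Set Z))) = T := by
    ext t
    simp [T, and_comm]
  rw [hT, Set.ncard_coe_finset]
  let W : Finset ((X × Y × Z) × (X × Y × Z)) := {p ∈ T ×ˢ T | p.1.1 = p.2.1}
  have hW : ∀ w ∈ W, ((w.1.1 ∈ A ∧ w.1.2.1 ∈ B ∧ w.1.2.2 ∈ C) ∧ w.1 ∈ F) ∧
      ((w.2.1 ∈ A ∧ w.2.2.1 ∈ B ∧ w.2.2.2 ∈ C) ∧ w.2 ∈ F) ∧ w.1.1 = w.2.1 := by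
    intro w hw
    simpa only [W, T, Finset.mem_filter, Finset.mem_product, and_assoc] using hw
  have hTW : T.card ^ 2 ≤ A.card * W.card :=
    card_sq_le_card_mul_card_filter_eq T A Prod.fst fun t ht =>
      (Finset.mem_product.1 (Finset.mem_filter.1 ht).1).1
  let PY : Finset (Y × Y) := {p ∈ B ×ˢ B | p ∈ Y₀}
  let PZ : Finset (Z × Z) := {p ∈ C ×ˢ C | p ∈ Z₀}
  have hPY : PY.card ≤ k₁ * n := by
    have h := hY₀ B B.finite_toSet
    have hP : (((B : Set Y) ×ˢ (B : Set Y)) ∩ Y₀) = PY := by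
      ext p
      simp [PY]
    rw [hP, Set.ncard_coe_finset, Set.ncard_coe_finset] at h
    exact h.trans (by gcongr)
  have hPZ : PZ.card ≤ k₂ * n := by
    have h := hZ₀ C C.finite_toSet
    have hP : (((C : Set Z) ×ˢ (C : Set Z)) ∩ Z₀) = PZ := by
      ext p
      simp [PZ]
    rw [hP, Set.ncard_coe_finset, Set.ncard_coe_finset] at h
    exact h.trans (by gcongr)
  let B' : Finset (Y × Y) := {p ∈ B ×ˢ B | p ∉ Y₀}
  let C' : Finset (Z × Z) := {p ∈ C ×ˢ C | p ∉ Z₀}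
  let Q : Finset ((Y × Y) × (Z × Z)) := {q ∈ B' ×ˢ C' | q ∈ Gset F}
  have hQ : (Q.card : ℝ) ≤ c₀ * ((n ^ 2 : ℕ) : ℝ) ^ ((3 : ℝ) / 2 - δ) := by
    have hB' : B'.card ≤ n ^ 2 := by
      refine (Finset.card_filter_le _ _).trans ?_
      rw [Finset.card_product, sq]
      exact Nat.mul_le_mul hBn hBn
    have hC' : C'.card ≤ n ^ 2 := by
      refine (Finset.card_filter_le _ _).trans ?_
      rw [Finset.card_product, sq]
      exact Nat.mul_le_mul hCn hCn
    have h := hbound (n ^ 2) B' C' (fun p hp => (Finset.mem_filter.1 hp).2)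
      (fun p hp => (Finset.mem_filter.1 hp).2) B'.finite_toSet C'.finite_toSet
      (by rwa [Set.ncard_coe_finset]) (by rwa [Set.ncard_coe_finset])
    have hGQ : Gset F ∩ ((B' : Set (Y × Y)) ×ˢ (C' : Set (Z × Z))) = Q := by
      ext q
      simp only [Q, Set.mem_inter_iff, Set.mem_prod, Finset.mem_coe, Finset.mem_filter,
        Finset.mem_product, and_comm]
    rwa [hGQ, Set.ncard_coe_finset] at h
  let WY := {w ∈ W | (w.1.2.1, w.2.2.1) ∈ Y₀}
  let WZ := {w ∈ W | (w.1.2.2, w.2.2.2) ∈ Z₀}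
  let WG := {w ∈ W | (w.1.2.1, w.2.2.1) ∉ Y₀ ∧ (w.1.2.2, w.2.2.2) ∉ Z₀}
  have hcover : W.card ≤ WY.card + WZ.card + WG.card := by
    have hsub : W ⊆ WY ∪ WZ ∪ WG := by
      intro w hw
      simp only [WY, WZ, WG, Finset.mem_union, Finset.mem_filter]
      tauto
    exact (Finset.card_le_card hsub).trans <| (Finset.card_union_le _ _).trans <|
      Nat.add_le_add_right (Finset.card_union_le _ _) _
  have hWY : WY.card ≤ d ^ 2 * (A.card * PY.card) := by
    refine card_pairs_le_of_snd_mem hFz A PY WY fun w hw => ?_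
    obtain ⟨hw, hY⟩ := Finset.mem_filter.1 hw
    obtain ⟨⟨⟨h₁, h₂, -⟩, h₃⟩, ⟨⟨-, h₄, -⟩, h₅⟩, h₆⟩ := hW w hw
    exact ⟨h₃, h₅, h₆, h₁, Finset.mem_filter.2 ⟨Finset.mem_product.2 ⟨h₂, h₄⟩, hY⟩⟩
  have hWZ : WZ.card ≤ d ^ 2 * (A.card * PZ.card) := by
    let e : X × Y × Z ≃ X × Z × Y := (Equiv.refl X).prodCongr (Equiv.prodComm Y Z)
    rw [← Finset.card_map (e.prodCongr e).toEmbedding]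
    refine card_pairs_le_of_snd_mem (F := e.symm ⁻¹' F) hFy A PZ _ fun w hw => ?_
    obtain ⟨w, hwZ, rfl⟩ := Finset.mem_map.1 hw
    obtain ⟨hw, hZ⟩ := Finset.mem_filter.1 hwZ
    obtain ⟨⟨⟨h₁, -, h₂⟩, h₃⟩, ⟨⟨-, -, h₄⟩, h₅⟩, h₆⟩ := hW w hw
    exact ⟨h₃, h₅, h₆, h₁, Finset.mem_filter.2 ⟨Finset.mem_product.2 ⟨h₂, h₄⟩, hZ⟩⟩
  have hWG : WG.card ≤ d * Q.card := by
    refine card_pairs_le_of_mem_Gset hFx Q WG fun w hw => ?_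
    obtain ⟨hw, hY, hZ⟩ := Finset.mem_filter.1 hw
    obtain ⟨⟨⟨-, h₁, h₂⟩, h₃⟩, ⟨⟨-, h₄, h₅⟩, h₆⟩, h₇⟩ := hW w hw
    refine ⟨h₃, h₇, Finset.mem_filter.2 ⟨Finset.mem_product.2
      ⟨Finset.mem_filter.2 ⟨Finset.mem_product.2 ⟨h₁, h₄⟩, hY⟩,
        Finset.mem_filter.2 ⟨Finset.mem_product.2 ⟨h₂, h₅⟩, hZ⟩⟩, w.1.1, h₃, ?_⟩⟩
    rw [h₇]
    exact h₆
  have hcount : T.card ^ 2 ≤ n * (d ^ 2 * (k₁ + k₂) * n ^ 2 + d * Q.card) :=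
    calc T.card ^ 2 ≤ A.card * W.card := hTW
      _ ≤ n * (d ^ 2 * (n * (k₁ * n)) + d ^ 2 * (n * (k₂ * n)) + d * Q.card) := by
          refine Nat.mul_le_mul hAn (hcover.trans ?_)
          gcongr
          · exact hWY.trans (by gcongr)
          · exact hWZ.trans (by gcongr)
      _ = n * (d ^ 2 * (k₁ + k₂) * n ^ 2 + d * Q.card) := by ring
  calc (T.card : ℝ) ^ 2 ≤ n * ((d ^ 2 * (k₁ + k₂) : ℕ) * n ^ 2 + d * Q.card) := by
        exact_mod_cast hcount
    _ ≤ _ := by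
        rw [mul_assoc (d : ℝ) c₀]
        gcongr
end
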